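/- In the continued fraction setting (M of the parametrized form with γ > 0 and α Diophantine of exponent ε, times t_0 = 0 < t_1 < t_2 < ⋯, P^{(n)} ∈ SL(d,ℤ) with M^{(n)} := P^{(n)} M E^{t_n} ∈ S_d(κ), θ = (d−1)ε/(d+(d−1)ε)), set γ^{(n)} := the (d,d) entry of M^{(n)}. Then there is a constant c₇ > 0 such that for all n ≥ 0: c₇·exp[−θ(d²/(1−θ) − (d−1))·t_n] ≤ |γ^{(n)}| ≤ c₁·exp[(d−1)θ t_n], where c₁ is the constant bounding ‖M^{(n)}‖ ≤ c₁ exp[(d−1)θ t_n]. -/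

import Mathlib

open scoped BigOperators
open Matrix

noncomputable section

/-- `E^t = diag(e^{-t},…,e^{-t}, e^{(d-1)t})` on `ℝ^d` with `d = m+1`. -/
def Emat (m : ℕ) (t : ℝ) : Matrix (Fin (m+1)) (Fin (m+1)) ℝ :=
  Matrix.diagonal (Fin.snoc (fun _ : Fin m => Real.exp (-t)) (Real.exp ((m : ℝ) * t)))

/-- The block matrix `[[1, α],[0, 1]]` (sizes `(m)+(1)`). -/
def blockU {m : ℕ} (α : Fin m → ℝ) : Matrix (Fin (m+1)) (Fin (m+1)) ℝ :=
  Matrix.of (Fin.snoc (fun i : Fin m =>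
      Fin.snoc (fun j : Fin m => if i = j then (1:ℝ) else 0) (α i))
    (Fin.snoc (fun _ : Fin m => (0:ℝ)) 1))

/-- The block matrix `[[A, 0],[ᵀβ, γ]]` (sizes `(m)+(1)`). -/
def blockL {m : ℕ} (A : Matrix (Fin m) (Fin m) ℝ) (β : Fin m → ℝ) (γ : ℝ) :
    Matrix (Fin (m+1)) (Fin (m+1)) ℝ :=
  Matrix.of (Fin.snoc (fun i : Fin m => Fin.snoc (fun j : Fin m => A i j) 0)
    (Fin.snoc β γ))

/-- `α ∈ ℝ^{d-1}` is Diophantine with exponent `ε` and constant `C`: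
`|m|^{(d-1)(1+ε)} |m·α + k| > C` for all `m ∈ ℤ^{d-1} ∖ {0}`, `k ∈ ℤ` (max norm). -/
def DioVec {m : ℕ} (α : Fin m → ℝ) (ε C : ℝ) : Prop :=
  ∀ q : Fin m → ℤ, q ≠ 0 → ∀ k : ℤ,
    C < ‖((fun i => (q i : ℝ)) : Fin m → ℝ)‖ ^ ((m : ℝ) * (1 + ε)) *
        |(∑ i, (q i : ℝ) * α i) + (k : ℝ)|

/-- The data of a Siegel-set decomposition `M = N ⬝ diagonal a ⬝ K` in `S_d(κ)`:
`N` unipotent upper triangular with entries bounded by `κ`, `a` positive with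
product `1` and `a j ≥ (√3/2) a (j+1)`, and `K ∈ SO(d)`. -/
def IsSiegelTriple {m : ℕ} (κ : ℝ) (N K : Matrix (Fin (m+1)) (Fin (m+1)) ℝ)
    (a : Fin (m+1) → ℝ) : Prop :=
  (∀ i, N i i = 1) ∧ (∀ i j : Fin (m+1), j < i → N i j = 0) ∧
  (∀ i j : Fin (m+1), i < j → |N i j| ≤ κ) ∧
  (∀ i, 0 < a i) ∧ (∏ i, a i = 1) ∧
  (∀ i : Fin m, Real.sqrt 3 / 2 * a i.succ ≤ a i.castSucc) ∧
  K * K.transpose = 1 ∧ K.det = 1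

/-- Membership in the Siegel set `S_d(κ)`. -/
def InSiegelSet {m : ℕ} (κ : ℝ) (M : Matrix (Fin (m+1)) (Fin (m+1)) ℝ) : Prop :=
  ∃ N K a, IsSiegelTriple κ N K a ∧ M = N * Matrix.diagonal a * K

/-- Euclidean norm on `ℝ^n`. -/
def eucNorm {n : ℕ} (v : Fin n → ℝ) : ℝ := Real.sqrt (∑ i, v i ^ 2)

/-- Operator norm of a matrix induced by the Euclidean norm. -/
def eucOpNorm {n : ℕ} (M : Matrix (Fin n) (Fin n) ℝ) : ℝ :=
  sSup {c | ∃ v : Fin n → ℝ, eucNorm v ≤ 1 ∧ c = eucNorm (M.mulVec v)}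

/-- `δ(M) = inf_{k ∈ ℤ^d ∖ {0}} |ᵀk M|` (max norm). -/
def deltaFn {m : ℕ} (M : Matrix (Fin (m+1)) (Fin (m+1)) ℝ) : ℝ :=
  ⨅ k : {k : Fin (m+1) → ℤ // k ≠ 0}, ‖Matrix.vecMul (fun i => (k.1 i : ℝ)) M‖

/-- `θ = (d-1)ε/(d + (d-1)ε)` with `d = m+1`. -/
def thetaOf (m : ℕ) (ε : ℝ) : ℝ := (m : ℝ) * ε / ((m + 1 : ℝ) + (m : ℝ) * ε)

end

/-- The linear form `q · α + l` attached to the vector `x = (q, l)`. -/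
noncomputable def linearForm {m : ℕ} (α : Fin m → ℝ) (x : Fin (m+1) → ℝ) : ℝ :=
  (∑ i : Fin m, x i.castSucc * α i) + x (Fin.last m)

theorem vecMul_mul_Emat_castSucc {m : ℕ} (M : Matrix (Fin (m+1)) (Fin (m+1)) ℝ)
    (x : Fin (m+1) → ℝ) (t : ℝ) (j : Fin m) :
    vecMul x (M * Emat m t) j.castSucc = vecMul x M j.castSucc * Real.exp (-t) := by
  rw [← vecMul_vecMul, Emat, vecMul_diagonal, Fin.snoc_castSucc]

theorem vecMul_mul_Emat_last {m : ℕ} (M : Matrix (Fin (m+1)) (Fin (m+1)) ℝ)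
    (x : Fin (m+1) → ℝ) (t : ℝ) :
    vecMul x (M * Emat m t) (Fin.last m) =
      vecMul x M (Fin.last m) * Real.exp ((m : ℝ) * t) := by
  rw [← vecMul_vecMul, Emat, vecMul_diagonal, Fin.snoc_last]

theorem vecMul_blockU_mul_blockL_last {m : ℕ} (α β : Fin m → ℝ)
    (A : Matrix (Fin m) (Fin m) ℝ) (γ : ℝ) (x : Fin (m+1) → ℝ) :
    vecMul x (blockU α * blockL A β γ) (Fin.last m) = linearForm α x * γ := by
  rw [← vecMul_vecMul]
  simp [vecMul, dotProduct, blockU, blockL, linearForm, Fin.sum_univ_castSucc]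

theorem exists_abs_le_of_vecMul_abs_le {m : ℕ} (M : Matrix (Fin (m+1)) (Fin (m+1)) ℝ)
    (hdet : M.det = 1) :
    ∃ K > (0:ℝ), ∀ (x : Fin (m+1) → ℝ) (B : ℝ), 0 ≤ B →
      (∀ j, |vecMul x M j| ≤ B) → ∀ i, |x i| ≤ K * B := by
  refine ⟨1 + ∑ i, ∑ j, |M⁻¹ j i|, by positivity, fun x B hB h i => ?_⟩
  have hx : x = vecMul (vecMul x M) M⁻¹ := by
    rw [vecMul_vecMul, Matrix.mul_nonsing_inv _ (by simp [hdet]), vecMul_one]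
  have h1 : |x i| ≤ (∑ j, |M⁻¹ j i|) * B := by
    conv_lhs => rw [hx]
    rw [vecMul, dotProduct, Finset.sum_mul]
    refine (Finset.abs_sum_le_sum_abs _ _).trans (Finset.sum_le_sum fun j _ => ?_)
    rw [abs_mul, mul_comm]
    exact mul_le_mul_of_nonneg_left (h j) (abs_nonneg _)
  have h2 : (∑ j, |M⁻¹ j i|) ≤ ∑ i, ∑ j, |M⁻¹ j i| :=
    Finset.single_le_sum (f := fun i => ∑ j, |M⁻¹ j i|)
      (fun i _ => Finset.sum_nonneg fun j _ => abs_nonneg _) (Finset.mem_univ i)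
  exact h1.trans (mul_le_mul_of_nonneg_right (by linarith) hB)

theorem DioVec.linearForm_lower_bound {m : ℕ} {α : Fin m → ℝ} {ε C : ℝ} (hε : 0 < ε)
    (hdio : DioVec α ε C) (k : Fin (m+1) → ℤ) (hk : k ≠ 0) (R : ℝ) (hR0 : 0 ≤ R)
    (hR : ∀ i, |(k i : ℝ)| ≤ R) :
    1 ≤ |linearForm α (fun i => (k i : ℝ))| ∨
      C < R ^ ((m : ℝ) * (1 + ε)) * |linearForm α (fun i => (k i : ℝ))| := by
  by_cases hq : (fun i : Fin m => k i.castSucc) = 0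
  · left
    have hq' : ∀ i : Fin m, k i.castSucc = 0 := fun i => congrFun hq i
    have hl : k (Fin.last m) ≠ 0 := fun hl => hk <| by
      funext i
      refine Fin.lastCases hl hq' i
    simp only [linearForm, hq', Int.cast_zero, zero_mul, Finset.sum_const_zero, zero_add]
    exact_mod_cast Int.one_le_abs hl
  · right
    refine (hdio _ hq (k (Fin.last m))).trans_le ?_
    refine mul_le_mul_of_nonneg_right ?_ (abs_nonneg _)
    refine Real.rpow_le_rpow (norm_nonneg _) ?_ (by positivity)
    exact (pi_norm_le_iff_of_nonneg hR0).2 fun i => hR i.castSucc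

theorem last_entry_dichotomy {m : ℕ} (α β : Fin m → ℝ)
    (A : Matrix (Fin m) (Fin m) ℝ) (γ : ℝ) (hγ : 0 < γ) (ε C : ℝ) (hε : 0 < ε)
    (hdio : DioVec α ε C) (hdet : (blockU α * blockL A β γ).det = 1) :
    ∃ K > (0:ℝ), ∀ t : ℝ, 0 ≤ t → ∀ k : Fin (m+1) → ℤ, k ≠ 0 → ∀ B : ℝ, 0 ≤ B →
      (∀ j, |vecMul (fun i => (k i : ℝ)) (blockU α * blockL A β γ * Emat m t) j| ≤ B) →
      γ ≤ |vecMul (fun i => (k i : ℝ)) (blockU α * blockL A β γ * Emat m t) (Fin.last m)| ∨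
      C * γ ≤ K * B ^ ((m : ℝ) * (1 + ε)) * Real.exp ((m : ℝ) * ε * t) *
        |vecMul (fun i => (k i : ℝ)) (blockU α * blockL A β γ * Emat m t) (Fin.last m)| := by
  obtain ⟨K, hK, h⟩ := exists_abs_le_of_vecMul_abs_le _ hdet
  refine ⟨K ^ ((m : ℝ) * (1 + ε)), by positivity, fun t ht k hk B hB hv => ?_⟩
  have hmt : 0 ≤ (m : ℝ) * t := by positivity
  have hrow : ∀ j, |vecMul (fun i => (k i : ℝ)) (blockU α * blockL A β γ) j| ≤
      Real.exp t * B := by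
    intro j
    induction j using Fin.lastCases with
    | last =>
      have := hv (Fin.last m)
      rw [vecMul_mul_Emat_last, abs_mul, Real.abs_exp] at this
      have h1 : 1 ≤ Real.exp ((m : ℝ) * t) := Real.one_le_exp hmt
      have h2 : 1 ≤ Real.exp t := Real.one_le_exp ht
      calc _ ≤ _ := le_mul_of_one_le_right (abs_nonneg _) h1
        _ ≤ B := this
        _ ≤ _ := le_mul_of_one_le_left hB h2
    | cast j =>
      have := hv j.castSucc
      rw [vecMul_mul_Emat_castSucc, abs_mul, Real.abs_exp] at this
      calc _ = Real.exp t * (|vecMul (fun i => (k i : ℝ)) (blockU α * blockL A β γ) j.castSucc| *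
                Real.exp (-t)) := by
              rw [mul_left_comm, ← Real.exp_add]; simp
        _ ≤ _ := mul_le_mul_of_nonneg_left this (Real.exp_pos _).le
  have hR := h _ _ (by positivity) hrow
  rw [vecMul_mul_Emat_last, vecMul_blockU_mul_blockL_last, abs_mul, abs_mul, Real.abs_exp,
    abs_of_pos hγ]
  rcases hdio.linearForm_lower_bound hε k hk _ (by positivity) hR with h1 | h1
  · left
    have h3 : 1 ≤ Real.exp ((m : ℝ) * t) := Real.one_le_exp hmt
    calc γ = 1 * γ * 1 := by ring
      _ ≤ _ := by gcongr
  · right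
    rw [Real.mul_rpow hK.le (by positivity), Real.mul_rpow (Real.exp_pos _).le hB,
      ← Real.exp_mul] at h1
    have h4 : Real.exp (t * ((m : ℝ) * (1 + ε))) =
        Real.exp ((m : ℝ) * ε * t) * Real.exp ((m : ℝ) * t) := by
      rw [← Real.exp_add]; congr 1; ring
    rw [h4] at h1
    calc C * γ ≤ _ * γ := mul_le_mul_of_nonneg_right h1.le hγ.le
      _ = _ := by ring

theorem exists_row_lower_bound {m : ℕ} (α β : Fin m → ℝ)
    (A : Matrix (Fin m) (Fin m) ℝ) (γ : ℝ) (hγ : 0 < γ) (ε C : ℝ) (hε : 0 < ε) (hC : 0 < C)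
    (hdio : DioVec α ε C) (hdet : (blockU α * blockL A β γ).det = 1) :
    ∃ c > (0:ℝ), ∀ t : ℝ, 0 ≤ t → ∀ k : Fin (m+1) → ℤ, k ≠ 0 → ∀ B : ℝ, 0 < B →
      (∀ j, |vecMul (fun i => (k i : ℝ)) (blockU α * blockL A β γ * Emat m t) j| ≤ B) →
      c * Real.exp (-thetaOf m ε * t) ≤ B := by
  obtain ⟨K, hK, h⟩ := last_entry_dichotomy α β A γ hγ ε C hε hdio hdet
  have hp : 0 < (m : ℝ) * (1 + ε) + 1 := by positivity
  refine ⟨min γ ((C * γ / K) ^ ((m : ℝ) * (1 + ε) + 1)⁻¹), by positivity,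
    fun t ht k hk B hB hv => ?_⟩
  rcases h t ht k hk B hB.le hv with h1 | h1
  · have hθ : Real.exp (-thetaOf m ε * t) ≤ 1 := by
      rw [Real.exp_le_one_iff, neg_mul, Left.neg_nonpos_iff]
      unfold thetaOf
      positivity
    calc _ ≤ γ * 1 := mul_le_mul (min_le_left _ _) hθ (Real.exp_pos _).le hγ.le
      _ ≤ B := by rw [mul_one]; exact h1.trans (hv _)
  · have h2 : C * γ / K * Real.exp (-((m : ℝ) * ε * t)) ≤ B ^ ((m : ℝ) * (1 + ε) + 1) := by
      rw [Real.rpow_add_one hB.ne', Real.exp_neg, ← div_eq_mul_inv, div_div,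
        div_le_iff₀ (by positivity)]
      calc C * γ ≤ _ := h1
        _ ≤ K * B ^ ((m : ℝ) * (1 + ε)) * Real.exp ((m : ℝ) * ε * t) * B :=
            mul_le_mul_of_nonneg_left (hv _) (by positivity)
        _ = _ := by ring
    have h3 := Real.rpow_le_rpow (by positivity) h2 (inv_pos.2 hp).le
    rw [Real.rpow_rpow_inv hB.le hp.ne', Real.mul_rpow (by positivity) (Real.exp_pos _).le,
      ← Real.exp_mul] at h3
    have h4 : -thetaOf m ε * t = -((m : ℝ) * ε * t) * ((m : ℝ) * (1 + ε) + 1)⁻¹ := by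
      have : (m : ℝ) * (1 + ε) + 1 = (m + 1 : ℝ) + m * ε := by ring
      rw [this, thetaOf]
      ring
    rw [h4]
    exact (mul_le_mul_of_nonneg_right (min_le_right _ _) (Real.exp_pos _).le).trans h3

theorem exists_last_entry_lower_bound {m : ℕ} (α β : Fin m → ℝ)
    (A : Matrix (Fin m) (Fin m) ℝ) (γ : ℝ) (hγ : 0 < γ) (ε C : ℝ) (hε : 0 < ε) (hC : 0 < C)
    (hdio : DioVec α ε C) (hdet : (blockU α * blockL A β γ).det = 1) (B : ℝ) (hB : 0 < B) :
    ∃ c > (0:ℝ), ∀ t : ℝ, 0 ≤ t → ∀ k : Fin (m+1) → ℤ, k ≠ 0 →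
      (∀ j, |vecMul (fun i => (k i : ℝ)) (blockU α * blockL A β γ * Emat m t) j| ≤ B) →
      c * Real.exp (-((m : ℝ) * ε * t)) ≤
        |vecMul (fun i => (k i : ℝ)) (blockU α * blockL A β γ * Emat m t) (Fin.last m)| := by
  obtain ⟨K, hK, h⟩ := last_entry_dichotomy α β A γ hγ ε C hε hdio hdet
  refine ⟨min γ (C * γ / (K * B ^ ((m : ℝ) * (1 + ε)))), by positivity,
    fun t ht k hk hv => ?_⟩
  rcases h t ht k hk B hB.le hv with h1 | h1
  · have hexp : Real.exp (-((m : ℝ) * ε * t)) ≤ 1 := by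
      rw [Real.exp_le_one_iff, Left.neg_nonpos_iff]
      positivity
    calc _ ≤ γ * 1 := mul_le_mul (min_le_left _ _) hexp (Real.exp_pos _).le hγ.le
      _ ≤ _ := by rwa [mul_one]
  · refine (mul_le_mul_of_nonneg_right (min_le_right _ _) (Real.exp_pos _).le).trans ?_
    rw [Real.exp_neg, ← div_eq_mul_inv, div_div, div_le_iff₀ (by positivity)]
    linarith

theorem abs_apply_le_one_of_mul_transpose_eq_one {n : Type*} [Fintype n] [DecidableEq n]
    {K : Matrix n n ℝ} (hK : K * K.transpose = 1) (i j : n) : |K i j| ≤ 1 := by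
  have h1 : ∑ l, K i l * K i l = 1 := by
    simpa [Matrix.mul_apply] using congrFun (congrFun hK i) i
  have h2 : K i j * K i j ≤ 1 := by
    rw [← h1]
    exact Finset.single_le_sum (f := fun l => K i l * K i l)
      (fun l _ => mul_self_nonneg _) (Finset.mem_univ j)
  exact abs_le_one_iff_mul_self_le_one.2 h2

namespace IsSiegelTriple

variable {m : ℕ} {κ : ℝ} {N K : Matrix (Fin (m+1)) (Fin (m+1)) ℝ} {a : Fin (m+1) → ℝ}

theorem pow_mul_last_le (h : IsSiegelTriple κ N K a) (i : Fin (m+1)) :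
    (Real.sqrt 3 / 2) ^ m * a (Fin.last m) ≤ a i := by
  obtain ⟨-, -, -, ha, -, hr, -, -⟩ := h
  have hr0 : 0 ≤ Real.sqrt 3 / 2 := by positivity
  have hr1 : Real.sqrt 3 / 2 ≤ 1 := by
    rw [div_le_one (by norm_num), Real.sqrt_le_left (by norm_num)]
    norm_num
  have key : (Real.sqrt 3 / 2) ^ (m - (i : ℕ)) * a (Fin.last m) ≤ a i := by
    induction i using Fin.reverseInduction with
    | last => simp
    | cast i ih =>
      refine le_trans (le_of_eq ?_) ((mul_le_mul_of_nonneg_left ih hr0).trans (hr i))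
      have : m - (i.castSucc : ℕ) = (m - (i.succ : ℕ)) + 1 := by
        simp only [Fin.val_castSucc, Fin.val_succ]
        omega
      rw [this, pow_succ]
      ring
  exact (mul_le_mul_of_nonneg_right (pow_le_pow_of_le_one hr0 hr1 (Nat.sub_le _ _))
    (ha _).le).trans key

theorem mul_pow_le_one (h : IsSiegelTriple κ N K a) {L : ℝ} (hL : 0 ≤ L)
    (haL : ∀ i, L ≤ a i) (i : Fin (m+1)) : a i * L ^ m ≤ 1 := by
  obtain ⟨-, -, -, ha, hprod, -, -, -⟩ := h
  rw [← hprod, ← Finset.mul_prod_erase _ _ (Finset.mem_univ i)]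
  refine mul_le_mul_of_nonneg_left ?_ (ha i).le
  calc L ^ m = ∏ _j ∈ Finset.univ.erase i, L := by simp
    _ ≤ _ := Finset.prod_le_prod (fun _ _ => hL) fun j _ => haL j

theorem last_le (h : IsSiegelTriple κ N K a) :
    a (Fin.last m) ≤ ((Real.sqrt 3 / 2) ^ m)⁻¹ := by
  have hr : 0 < (Real.sqrt 3 / 2) ^ m := by positivity
  have ha : 0 < a (Fin.last m) := h.2.2.2.1 _
  have h1 := h.mul_pow_le_one (by positivity) h.pow_mul_last_le (Fin.last m)
  have h0 := h.pow_mul_last_le (Fin.last m)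
  rw [← one_div, le_div_iff₀ hr, mul_comm]
  by_contra! hcon
  have h2 : 1 ≤ ((Real.sqrt 3 / 2) ^ m * a (Fin.last m)) ^ m := one_le_pow₀ hcon.le
  nlinarith

theorem abs_last_row_le (h : IsSiegelTriple κ N K a) (j : Fin (m+1)) :
    |(N * Matrix.diagonal a * K) (Fin.last m) j| ≤ a (Fin.last m) := by
  obtain ⟨hN1, hN0, -, ha, -, -, hK, -⟩ := h
  have : (N * Matrix.diagonal a * K) (Fin.last m) j = a (Fin.last m) * K (Fin.last m) j := by
    rw [Matrix.mul_apply, Finset.sum_eq_single (Fin.last m)]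
    · rw [Matrix.mul_diagonal, hN1, one_mul]
    · intro l _ hl
      rw [Matrix.mul_diagonal, hN0 _ _ (lt_of_le_of_ne (Fin.le_last l) hl), zero_mul, zero_mul]
    · simp
  rw [this, abs_mul, abs_of_pos (ha _)]
  exact mul_le_of_le_one_right (ha _).le (abs_apply_le_one_of_mul_transpose_eq_one hK _ _)

theorem abs_apply_le (h : IsSiegelTriple κ N K a) (hκ : 0 < κ) {U : ℝ} (hU : ∀ i, a i ≤ U)
    (i j : Fin (m+1)) :
    |(N * Matrix.diagonal a * K) i j| ≤ (m + 1) * ((1 + κ) * U) := by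
  obtain ⟨hN1, hN0, hNκ, ha, -, -, hK, -⟩ := h
  have hU0 : 0 ≤ U := (ha i).le.trans (hU i)
  have hN : ∀ i l, |N i l| ≤ 1 + κ := by
    intro i l
    rcases lt_trichotomy i l with hil | rfl | hil
    · linarith [hNκ i l hil]
    · rw [hN1, abs_one]; linarith
    · rw [hN0 _ _ hil, abs_zero]; linarith
  rw [Matrix.mul_apply]
  calc _ ≤ ∑ l, |(N * Matrix.diagonal a) i l * K l j| := Finset.abs_sum_le_sum_abs _ _
    _ ≤ ∑ _l : Fin (m+1), (1 + κ) * U := by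
      refine Finset.sum_le_sum fun l _ => ?_
      rw [Matrix.mul_diagonal, abs_mul, abs_mul, abs_of_pos (ha l), ← mul_one ((1 + κ) * U)]
      have h1 := abs_apply_le_one_of_mul_transpose_eq_one hK l j
      gcongr
      exacts [(ha l).le, hN i l, hU l]
    _ = _ := by simp

end IsSiegelTriple

theorem eucOpNorm_le_of_abs_apply_le {n : ℕ} (X : Matrix (Fin n) (Fin n) ℝ) {B : ℝ}
    (hB : 0 ≤ B) (hX : ∀ i j, |X i j| ≤ B) : eucOpNorm X ≤ n * (n * B) := by
  refine Real.sSup_le ?_ (by positivity)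
  rintro _ ⟨v, hv, rfl⟩
  have hv1 : ∀ j, |v j| ≤ 1 := by
    intro j
    refine le_trans ?_ hv
    rw [eucNorm]
    refine Real.abs_le_sqrt ?_
    exact Finset.single_le_sum (f := fun j => v j ^ 2) (fun _ _ => sq_nonneg _)
      (Finset.mem_univ j)
  have hXv : ∀ i, |X.mulVec v i| ≤ n * B := by
    intro i
    rw [Matrix.mulVec, dotProduct]
    calc _ ≤ ∑ j, |X i j * v j| := Finset.abs_sum_le_sum_abs _ _
      _ ≤ ∑ _j : Fin n, B := by
        refine Finset.sum_le_sum fun j _ => ?_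
        rw [abs_mul, ← mul_one B]
        exact mul_le_mul (hX i j) (hv1 j) (abs_nonneg _) hB
      _ = _ := by simp
  rw [eucNorm]
  refine Real.sqrt_le_iff.2 ⟨by positivity, ?_⟩
  calc ∑ i, X.mulVec v i ^ 2 ≤ ∑ _i : Fin n, (n * B) ^ 2 := by
        refine Finset.sum_le_sum fun i _ => ?_
        exact sq_le_sq.2 ((hXv i).trans (le_abs_self _))
    _ = n * (n * B) ^ 2 := by simp
    _ ≤ n ^ 2 * (n * B) ^ 2 := by
        refine mul_le_mul_of_nonneg_right ?_ (sq_nonneg _)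
        exact_mod_cast Nat.le_self_pow two_ne_zero n
    _ = _ := by ring

theorem mul_le_thetaOf_exponent (m : ℕ) (hm : 1 ≤ m) (ε : ℝ) (hε : 0 < ε) :
    (m : ℝ) * ε ≤
      thetaOf m ε * (((m + 1 : ℝ)) ^ 2 / (1 - thetaOf m ε) - (m : ℝ)) := by
  have hm' : (1 : ℝ) ≤ m := by exact_mod_cast hm
  have hD : 0 < (m + 1 : ℝ) + m * ε := by positivity
  have h1 : 1 - thetaOf m ε = (m + 1 : ℝ) / ((m + 1 : ℝ) + m * ε) := by
    rw [thetaOf]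
    field_simp
    ring
  have h2 : thetaOf m ε * (((m + 1 : ℝ)) ^ 2 / (1 - thetaOf m ε) - (m : ℝ)) =
      (m + 1) * (m * ε) - m * thetaOf m ε := by
    rw [h1, thetaOf]
    field_simp
  have h3 : thetaOf m ε ≤ m * ε := by
    rw [thetaOf]
    exact div_le_self (by positivity) (by nlinarith)
  rw [h2]
  nlinarith [mul_le_mul_of_nonneg_left h3 (zero_le_one.trans hm')]

/-- (Bounds on `γ^{(n)}`, the `(d,d)` entry of `M^{(n)}`.)
In the continued fraction setting there are constants `c₁, c₇ > 0` with
`‖M^{(n)}‖ ≤ c₁ e^{(d-1)θ t_n}` and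
`c₇ e^{-θ(d²/(1-θ)-(d-1)) t_n} ≤ |γ^{(n)}| ≤ c₁ e^{(d-1)θ t_n}` for all `n`. -/
theorem cf_gamma_estimates (m : ℕ) (hm : 1 ≤ m) (κ : ℝ) (hκ : 0 < κ)
    (α β : Fin m → ℝ) (A : Matrix (Fin m) (Fin m) ℝ) (γ : ℝ) (hγ : 0 < γ)
    (ε C : ℝ) (hε : 0 < ε) (hC : 0 < C) (hdio : DioVec α ε C)
    (M : Matrix (Fin (m+1)) (Fin (m+1)) ℝ)
    (hM : M = blockU α * blockL A β γ) (hdet : M.det = 1)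
    (t : ℕ → ℝ) (ht0 : t 0 = 0) (htmono : StrictMono t)
    (P : ℕ → Matrix (Fin (m+1)) (Fin (m+1)) ℤ) (hP : ∀ n, (P n).det = 1)
    (Mn : ℕ → Matrix (Fin (m+1)) (Fin (m+1)) ℝ)
    (hMn : ∀ n, Mn n = ((P n).map (Int.cast : ℤ → ℝ)) * M * Emat m (t n))
    (hS : ∀ n, InSiegelSet κ (Mn n))
    (θ : ℝ) (hθ : θ = thetaOf m ε) :
    ∃ c₁ > (0:ℝ), ∃ c₇ > (0:ℝ), ∀ n : ℕ,
      eucOpNorm (Mn n) ≤ c₁ * Real.exp ((m : ℝ) * θ * t n) ∧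
      c₇ * Real.exp (-θ * (((m + 1 : ℝ)) ^ 2 / (1 - θ) - (m : ℝ)) * t n) ≤
        |(Mn n) (Fin.last m) (Fin.last m)| ∧
      |(Mn n) (Fin.last m) (Fin.last m)| ≤ c₁ * Real.exp ((m : ℝ) * θ * t n) := by
  subst hM hθ
  have ht : ∀ n, 0 ≤ t n := fun n => ht0 ▸ htmono.monotone (Nat.zero_le n)
  set ρ : ℝ := (Real.sqrt 3 / 2) ^ m
  have hρ0 : 0 < ρ := by positivity
  obtain ⟨c, hc, hlow⟩ := exists_row_lower_bound α β A γ hγ ε C hε hC hdio hdet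
  obtain ⟨c', hc', hlast⟩ := exists_last_entry_lower_bound α β A γ hγ ε C hε hC hdio hdet
    ρ⁻¹ (by positivity)
  have hk : ∀ n, P n (Fin.last m) ≠ 0 := fun n h0 => by
    have := Matrix.det_eq_zero_of_row_eq_zero (Fin.last m) fun j => congrFun h0 j
    simp [hP n] at this
  have hrow : ∀ n j, Mn n (Fin.last m) j =
      vecMul (fun i => (P n (Fin.last m) i : ℝ)) (blockU α * blockL A β γ * Emat m (t n)) j := by
    intro n j
    rw [hMn n, Matrix.mul_assoc, Matrix.mul_apply]
    rfl
  set U : ℝ := ((ρ * c) ^ m)⁻¹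
  have hU0 : 0 < U := by positivity
  set B : ℝ := (m + 1) * ((1 + κ) * U) with hB
  have hB0 : 0 < B := by positivity
  have hentry : ∀ n i j, |Mn n i j| ≤ B * Real.exp ((m : ℝ) * thetaOf m ε * t n) := by
    intro n i j
    obtain ⟨N, K, a, hT, hNaK⟩ := hS n
    have ha : c * Real.exp (-thetaOf m ε * t n) ≤ a (Fin.last m) := by
      refine hlow (t n) (ht n) _ (hk n) _ (hT.2.2.2.1 _) fun j => ?_
      rw [← hrow, hNaK]
      exact hT.abs_last_row_le j
    have haL : ∀ i, ρ * c * Real.exp (-thetaOf m ε * t n) ≤ a i := fun i =>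
      le_trans (by rw [mul_assoc]; exact mul_le_mul_of_nonneg_left ha hρ0.le)
        (hT.pow_mul_last_le i)
    have haU : ∀ i, a i ≤ U * Real.exp ((m : ℝ) * thetaOf m ε * t n) := by
      intro i
      have h1 := hT.mul_pow_le_one (by positivity) haL i
      rw [← le_div_iff₀ (by positivity)] at h1
      refine h1.trans (le_of_eq ?_)
      rw [mul_pow, ← Real.exp_nat_mul, one_div, mul_inv, ← Real.exp_neg]
      congr 2
      ring
    rw [hNaK]
    refine (hT.abs_apply_le hκ haU i j).trans (le_of_eq ?_)
    rw [hB]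
    ring
  have hm1 : (1 : ℝ) ≤ m + 1 := by linarith [Nat.cast_nonneg (α := ℝ) m]
  refine ⟨(m + 1) * ((m + 1) * B), by positivity, c', hc', fun n => ⟨?_, ?_, ?_⟩⟩
  · refine (eucOpNorm_le_of_abs_apply_le (Mn n) (by positivity) (hentry n)).trans (le_of_eq ?_)
    push_cast
    ring
  · refine le_trans ?_ ((hlast (t n) (ht n) _ (hk n) fun j => ?_).trans_eq (by rw [hrow]))
    · refine mul_le_mul_of_nonneg_left (Real.exp_le_exp.2 ?_) hc'.le
      have := mul_le_mul_of_nonneg_right (mul_le_thetaOf_exponent m hm ε hε) (ht n)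
      linarith
    · obtain ⟨N, K, a, hT, hNaK⟩ := hS n
      rw [← hrow, hNaK]
      exact (hT.abs_last_row_le j).trans hT.last_le
  · refine (hentry n _ _).trans (mul_le_mul_of_nonneg_right ?_ (Real.exp_pos _).le)
    have h1 : B ≤ (m + 1) * B := le_mul_of_one_le_left hB0.le hm1
    exact h1.trans (le_mul_of_one_le_left (by positivity) hm1)
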